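/- For each integer n ≥ 2 there exists a constant c_n > 0 such that for every irrational x ∈ (0, 1/(n+1)], B_n(x) − B_n(η_{n+1}) ≥ c_n · |x − η_{n+1}|^{1/2}, where η_{n+1} = (√((n+1)²+4) − (n+1))/2 and B_n(η_{n+1}) = η_{n+1}^{−1/n}/(1 − η_{n+1}). (Square-root scaling of the n-Brjuno function at its global minimum.) -/

import Mathlib

open Real Set MeasureTheory
open scoped ENNReal

/-- The Gauss map `A(x) = 1/x - ⌊1/x⌋`. -/
noncomputable def gaussMap (x : ℝ) : ℝ := 1 / x - (⌊1 / x⌋ : ℝ)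

/-- `brjunoBeta x j = β_{j-1}(x) = ∏_{i=0}^{j-1} A^i(x)`; in particular
`brjunoBeta x 0 = β_{-1}(x) = 1` and `β_K(x) = brjunoBeta x (K+1)`. -/
noncomputable def brjunoBeta (x : ℝ) (j : ℕ) : ℝ := ∏ i ∈ Finset.range j, gaussMap^[i] x

/-- The σ-Brjuno function `B_σ(x) = Σ_{j≥0} β_{j-1}(x) · (A^j x)^{-1/σ}`, valued in `[0,+∞]`. -/
noncomputable def brjuno (σ x : ℝ) : ℝ≥0∞ :=
  ∑' j : ℕ, ENNReal.ofReal (brjunoBeta x j * (gaussMap^[j] x) ^ (-(1 / σ)))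

/-- The K-th partial sum `B_σ^{(K)}(x) = Σ_{j=0}^{K} β_{j-1}(x) · (A^j x)^{-1/σ}`. -/
noncomputable def brjunoPartial (σ x : ℝ) (K : ℕ) : ℝ :=
  ∑ j ∈ Finset.range (K + 1), brjunoBeta x j * (gaussMap^[j] x) ^ (-(1 / σ))

/-- The fixed point `η_m = (√(m²+4) − m)/2 = [0; m, m, m, ...]` of the Gauss map. -/
noncomputable def eta (m : ℕ) : ℝ := (Real.sqrt ((m : ℝ) ^ 2 + 4) - m) / 2

/-- `b* = (σ+1)^{1+1/σ}/σ`. -/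
noncomputable def bstar (σ : ℝ) : ℝ := (σ + 1) ^ (1 + 1 / σ) / σ

/-- The global lower bound `g(x) = x^{-1/σ} + b*·x`. -/
noncomputable def gLow (σ x : ℝ) : ℝ := x ^ (-(1 / σ)) + bstar σ * x

/-- The cylinder lower bound `g_k(x) = x^{-1/σ} + x·(1/x − k)^{-1/σ} + (1 − kx)·b*`. -/
noncomputable def gCyl (σ : ℝ) (k : ℕ) (x : ℝ) : ℝ :=
  x ^ (-(1 / σ)) + x * (1 / x - (k : ℝ)) ^ (-(1 / σ)) + (1 - (k : ℝ) * x) * bstar σ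

section GaussMap

theorem irrational_gaussMap {x : ℝ} (hx : Irrational x) : Irrational (gaussMap x) := by
  unfold gaussMap
  rw [one_div]
  exact hx.inv.sub_intCast _

theorem gaussMap_mem_Ioo {x : ℝ} (hx : Irrational x) : gaussMap x ∈ Ioo (0 : ℝ) 1 := by
  have h : gaussMap x = Int.fract (1 / x) := rfl
  refine ⟨lt_of_le_of_ne (h ▸ Int.fract_nonneg _) fun h0 => ?_, h ▸ Int.fract_lt_one _⟩
  exact (irrational_gaussMap hx).ne_zero h0.symm

theorem mul_add_gaussMap_eq_one {x : ℝ} {k : ℕ} (hk : 0 < k)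
    (hx₁ : 1 / ((k : ℝ) + 1) < x) (hx₂ : x < 1 / (k : ℝ)) : x * (k + gaussMap x) = 1 := by
  have hk' : (0 : ℝ) < k := by exact_mod_cast hk
  have hx0 : 0 < x := lt_trans (by positivity) hx₁
  have hfl : ⌊1 / x⌋ = (k : ℤ) := by
    rw [Int.floor_eq_iff]
    refine ⟨?_, ?_⟩
    · push_cast
      rw [le_div_iff₀ hx0]
      rw [lt_div_iff₀ hk'] at hx₂
      linarith
    · push_cast
      rw [div_lt_iff₀ hx0]
      rw [div_lt_iff₀ (by positivity)] at hx₁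
      linarith
  unfold gaussMap
  rw [hfl]
  push_cast
  field_simp
  ring

theorem mul_gaussMap_le_half {x : ℝ} (hx : Irrational x) (hx₀ : 0 < x) (hx₁ : x < 1) :
    x * gaussMap x ≤ 1 / 2 := by
  obtain ⟨hy₀, hy₁⟩ := gaussMap_mem_Ioo hx
  have hfl : (1 : ℝ) ≤ (⌊1 / x⌋ : ℝ) := by
    have : (1 : ℤ) ≤ ⌊1 / x⌋ := by
      rw [Int.le_floor, le_div_iff₀ hx₀]
      push_cast
      linarith
    exact_mod_cast this
  have h : x * gaussMap x = 1 - ⌊1 / x⌋ * x := by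
    unfold gaussMap
    field_simp
  nlinarith

end GaussMap

section Recursion

theorem brjunoBeta_succ (x : ℝ) (j : ℕ) :
    brjunoBeta x (j + 1) = x * brjunoBeta (gaussMap x) j := by
  simp only [brjunoBeta, Finset.prod_range_succ', Function.iterate_succ_apply,
    Function.iterate_zero, id_eq, mul_comm]

theorem brjuno_eq_add (σ : ℝ) {x : ℝ} (hx : 0 ≤ x) :
    brjuno σ x = ENNReal.ofReal (x ^ (-(1 / σ))) + ENNReal.ofReal x * brjuno σ (gaussMap x) := by
  unfold brjuno
  rw [tsum_eq_zero_add' ENNReal.summable, ← ENNReal.tsum_mul_left]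
  congr 1
  · simp [brjunoBeta]
  · refine tsum_congr fun j => ?_
    rw [brjunoBeta_succ, Function.iterate_succ_apply, ← ENNReal.ofReal_mul hx, mul_assoc]

/-- The irrational points of `(0,1)` at which `B_σ` is finite. -/
def brjunoFinite (σ : ℝ) : Set ℝ := {x | Irrational x ∧ x ∈ Ioo (0 : ℝ) 1 ∧ brjuno σ x ≠ ⊤}

theorem gaussMap_mem_brjunoFinite {σ x : ℝ} (hx : x ∈ brjunoFinite σ) :
    gaussMap x ∈ brjunoFinite σ := by
  obtain ⟨hi, ⟨h0, -⟩, hf⟩ := hx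
  refine ⟨irrational_gaussMap hi, gaussMap_mem_Ioo hi, fun htop => hf ?_⟩
  rw [brjuno_eq_add σ h0.le, htop, ENNReal.mul_top (by simpa using h0), add_top]

theorem toReal_brjuno_eq_add {σ x : ℝ} (hx : x ∈ brjunoFinite σ) :
    (brjuno σ x).toReal = x ^ (-(1 / σ)) + x * (brjuno σ (gaussMap x)).toReal := by
  have hy := (gaussMap_mem_brjunoFinite hx).2.2
  obtain ⟨-, ⟨h0, -⟩, -⟩ := hx
  rw [brjuno_eq_add σ h0.le, ENNReal.toReal_add ENNReal.ofReal_ne_top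
    (ENNReal.mul_ne_top ENNReal.ofReal_ne_top hy), ENNReal.toReal_mul,
    ENNReal.toReal_ofReal h0.le, ENNReal.toReal_ofReal (by positivity)]

end Recursion

section Bernoulli

/-- The graph of `x ↦ x ^ (-p)` lies above its tangent lines. -/
theorem rpow_neg_tangent_le {p a x : ℝ} (hp : 0 ≤ p) (ha : 0 < a) (hx : 0 < x) :
    a ^ (-p) * (1 - p * (x - a) / a) ≤ x ^ (-p) := by
  have hr : 0 < x / a := by positivity
  have h1 : 1 - p * (x / a - 1) ≤ (x / a) ^ (-p) := by
    rw [rpow_def_of_pos hr]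
    have := add_one_le_exp (log (x / a) * -p)
    have := log_le_sub_one_of_pos hr
    nlinarith
  have h2 : x ^ (-p) = a ^ (-p) * (x / a) ^ (-p) := by
    rw [← mul_rpow ha.le hr.le, mul_div_cancel₀ _ ha.ne']
  rw [h2]
  refine mul_le_mul_of_nonneg_left (le_trans (le_of_eq ?_) h1) (by positivity)
  field_simp

theorem bstar_eq {N : ℝ} (hN : 0 < N) :
    bstar N = (N + 1) ^ (1 / N) * (N + 1) / N := by
  unfold bstar
  rw [rpow_add (by positivity), rpow_one, mul_comm]

theorem bstar_pos {N : ℝ} (hN : 0 < N) : 0 < bstar N := by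
  rw [bstar_eq hN]; positivity

theorem bstar_mul_one_sub_le {N x : ℝ} (hN : 0 < N) (hx : 0 < x) :
    bstar N * (1 - x) ≤ x ^ (-(1 / N)) := by
  have h := rpow_neg_tangent_le (p := 1 / N) (a := (N + 1)⁻¹) (by positivity) (by positivity) hx
  rw [inv_rpow (by positivity), rpow_neg (by positivity), inv_inv] at h
  refine le_trans (le_of_eq ?_) h
  rw [bstar_eq hN]
  field_simp
  ring

theorem bstar_le_toReal_brjuno {N x : ℝ} (hN : 0 < N) (hx : x ∈ brjunoFinite N) :
    bstar N ≤ (brjuno N x).toReal := by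
  have step : ∀ x ∈ brjunoFinite N, x * ((brjuno N (gaussMap x)).toReal - bstar N) ≤
      (brjuno N x).toReal - bstar N := fun x hx => by
    have := bstar_mul_one_sub_le hN hx.2.1.1
    rw [toReal_brjuno_eq_add hx]
    linarith
  have hb := bstar_pos hN
  have key : ∀ k : ℕ, ∀ x ∈ brjunoFinite N,
      -(bstar N * (1 / 2) ^ k) ≤ (brjuno N x).toReal - bstar N := by
    intro k
    induction k with
    | zero =>
      intro x _
      simp
    | succ k ih =>
      intro x hx
      have hy := gaussMap_mem_brjunoFinite hx
      have h1 := step x hx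
      have h2 := mul_le_mul_of_nonneg_left (step _ hy) hx.2.1.1.le
      have h3 := ih _ (gaussMap_mem_brjunoFinite hy)
      have h4 := mul_gaussMap_le_half hx.1 hx.2.1.1 hx.2.1.2
      have h5 : 0 ≤ x * gaussMap x := mul_nonneg hx.2.1.1.le hy.2.1.1.le
      have h6 : 0 < bstar N * (1 / 2) ^ k := by positivity
      rw [pow_succ]
      nlinarith [mul_le_mul_of_nonneg_left h3 h5]
  have hlim : Filter.Tendsto (fun k : ℕ => -(bstar N * (1 / 2 : ℝ) ^ k)) Filter.atTop (nhds 0) := by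
    simpa using ((tendsto_pow_atTop_nhds_zero_of_lt_one (r := (1 / 2 : ℝ)) (by norm_num)
      (by norm_num)).const_mul (bstar N)).neg
  linarith [le_of_tendsto' hlim fun k => key k x hx]

theorem gLow_le_toReal_brjuno {N x : ℝ} (hN : 0 < N) (hx : x ∈ brjunoFinite N) :
    gLow N x ≤ (brjuno N x).toReal := by
  rw [toReal_brjuno_eq_add hx, gLow, mul_comm (bstar N)]
  have := bstar_le_toReal_brjuno hN (gaussMap_mem_brjunoFinite hx)
  have := mul_le_mul_of_nonneg_left this hx.2.1.1.le
  linarith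

theorem gLow_mono {N a z : ℝ} (hN : 0 < N) (ha : 1 / (N + 1) ≤ a) (haz : a ≤ z) :
    gLow N a ≤ gLow N z := by
  have ha0 : 0 < a := lt_of_lt_of_le (by positivity) ha
  have h := rpow_neg_tangent_le (p := 1 / N) (by positivity) ha0 (ha0.trans_le haz)
  have hinv : a⁻¹ ≤ N + 1 := by
    rw [inv_le_comm₀ ha0 (by positivity), ← one_div]; exact ha
  have h1 : a ^ (-(1 / N)) ≤ (N + 1) ^ (1 / N) := by
    rw [rpow_neg ha0.le, ← inv_rpow ha0.le]
    exact rpow_le_rpow (by positivity) hinv (by positivity)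
  have h2 : a ^ (-(1 / N)) * a⁻¹ / N ≤ bstar N := by
    rw [bstar_eq hN]
    gcongr
  have h3 := mul_le_mul_of_nonneg_right h2 (sub_nonneg.2 haz)
  have h4 : a ^ (-(1 / N)) * (1 - 1 / N * (z - a) / a) =
      a ^ (-(1 / N)) - a ^ (-(1 / N)) * a⁻¹ / N * (z - a) := by
    field_simp
  unfold gLow
  linarith

theorem rpow_one_div_ge {N u : ℝ} (hN : 1 ≤ N) (hu : 0 < u) (hu' : u ≤ N + 1) :
    (N + 1) ^ (1 / N) * (N * u / (N * u + (N + 1 - u))) ≤ u ^ (1 / N) := by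
  have hN0 : 0 < N := by linarith
  have hs : 0 ≤ (N + 1) / u - 1 := by
    rw [sub_nonneg, le_div_iff₀ hu]; linarith
  have h := rpow_one_add_le_one_add_mul_self (s := (N + 1) / u - 1) (p := 1 / N) (by linarith)
    (by positivity) (by rw [div_le_one hN0]; exact hN)
  rw [add_sub_cancel, div_rpow (by positivity) hu.le, div_le_iff₀ (by positivity)] at h
  have hden : 0 < N * u + (N + 1 - u) := by nlinarith
  rw [← mul_div_assoc, div_le_iff₀ hden]
  have h2 := mul_le_mul_of_nonneg_right h (by positivity : 0 ≤ N * u)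
  refine h2.trans (le_of_eq ?_)
  field_simp

end Bernoulli

section Minimum

theorem eta_pos (m : ℕ) : 0 < eta m := by
  have : (m : ℝ) < √((m : ℝ) ^ 2 + 4) := lt_sqrt_of_sq_lt (by linarith)
  unfold eta
  linarith

theorem eta_mul_add (m : ℕ) : eta m * (m + eta m) = 1 := by
  have := sq_sqrt (show (0 : ℝ) ≤ (m : ℝ) ^ 2 + 4 by positivity)
  unfold eta
  nlinarith

theorem eta_sq_le (m : ℕ) : eta m ^ 2 ≤ 1 / ((m : ℝ) ^ 2 + 1) := by
  have h0 := eta_pos m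
  have h1 := eta_mul_add m
  have hm : (0 : ℝ) ≤ m := m.cast_nonneg
  rw [le_div_iff₀ (by positivity)]
  nlinarith [mul_nonneg hm h0.le, sq_nonneg (eta m), mul_nonneg hm (pow_pos h0 3).le]

theorem eta_mul_lt_one (m : ℕ) : eta m * m < 1 := by
  nlinarith [eta_pos m, eta_mul_add m]

theorem gaussMap_eta {m : ℕ} (hm : 1 ≤ m) : gaussMap (eta m) = eta m := by
  have h0 := eta_pos m
  have h1 := eta_mul_add m
  have hm' : (1 : ℝ) ≤ m := by exact_mod_cast hm
  have := mul_add_gaussMap_eq_one (x := eta m) (k := m) (by omega)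
    (by rw [div_lt_iff₀ (by positivity)]; nlinarith)
    (by rw [lt_div_iff₀ (by positivity)]; exact eta_mul_lt_one m)
  have := mul_left_cancel₀ h0.ne' (this.trans h1.symm)
  linarith

/-- The value of `B_σ` at the fixed point `η_m`. -/
noncomputable def brjunoEta (σ : ℝ) (m : ℕ) : ℝ := eta m ^ (-(1 / σ)) / (1 - eta m)

theorem eta_lt_one {m : ℕ} (hm : 1 ≤ m) : eta m < 1 := by
  have h0 := eta_pos m
  have hm' : (1 : ℝ) ≤ m := by exact_mod_cast hm
  nlinarith [eta_mul_lt_one m]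

theorem brjuno_eta (σ : ℝ) {m : ℕ} (hm : 1 ≤ m) :
    brjuno σ (eta m) = ENNReal.ofReal (brjunoEta σ m) := by
  have h0 := eta_pos m
  have h1 := eta_lt_one hm
  have hit : ∀ j : ℕ, gaussMap^[j] (eta m) = eta m := fun j =>
    Function.iterate_fixed (gaussMap_eta hm) j
  unfold brjuno brjunoBeta brjunoEta
  simp only [hit, Finset.prod_const, Finset.card_range]
  rw [← ENNReal.ofReal_tsum_of_nonneg (fun j => by positivity)
    ((summable_geometric_of_lt_one h0.le h1).mul_right _), tsum_mul_right,
    tsum_geometric_of_lt_one h0.le h1, mul_comm, ← div_eq_mul_inv]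

theorem brjunoEta_pos (σ : ℝ) {m : ℕ} (hm : 1 ≤ m) : 0 < brjunoEta σ m :=
  div_pos (rpow_pos_of_pos (eta_pos m) _) (sub_pos.2 (eta_lt_one hm))

variable {n : ℕ}

theorem bstar_le_brjunoEta (hn : 2 ≤ n) : bstar n ≤ brjunoEta n (n + 1) := by
  have h1 : eta (n + 1) < 1 := eta_lt_one (by omega)
  rw [brjunoEta, le_div_iff₀ (by linarith)]
  exact bstar_mul_one_sub_le (by positivity) (eta_pos _)

theorem brjunoEta_le (hn : 2 ≤ n) :
    brjunoEta n (n + 1) ≤ bstar n * (1 + eta (n + 1) ^ 2 / (((n : ℝ) + 1) ^ 2 * n)) := by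
  have hN : (2 : ℝ) ≤ n := by exact_mod_cast hn
  have h0 := eta_pos (n + 1)
  have h1 : eta (n + 1) < 1 := eta_lt_one (by omega)
  have he := eta_mul_add (n + 1)
  unfold brjunoEta
  push_cast at he
  set e := eta (n + 1)
  set N : ℝ := (n : ℝ)
  have hinv : e⁻¹ = N + 1 + e := by field_simp; linarith
  have hs := rpow_one_add_le_one_add_mul_self (s := e / (N + 1)) (p := 1 / N)
    (by have : 0 < e / (N + 1) := by positivity
        linarith) (by positivity) (by rw [div_le_one (by positivity)]; linarith)
  have hp : e ^ (-(1 / N)) ≤ (N + 1) ^ (1 / N) * (1 + 1 / N * (e / (N + 1))) := by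
    rw [rpow_neg h0.le, ← inv_rpow h0.le, hinv,
      show N + 1 + e = (N + 1) * (1 + e / (N + 1)) by field_simp,
      mul_rpow (by positivity) (by positivity)]
    gcongr
  have hQ : 0 < (N + 1) ^ (1 / N) := by positivity
  rw [bstar_eq (by positivity), div_le_iff₀ (by linarith)]
  refine hp.trans ?_
  set Q := (N + 1) ^ (1 / N)
  have h1e : 1 - e = e * (N + e) := by linarith
  rw [h1e, show Q * (N + 1) / N * (1 + e ^ 2 / ((N + 1) ^ 2 * N)) * (e * (N + e)) =
    Q * ((N + 1) / N * (1 + e ^ 2 / ((N + 1) ^ 2 * N)) * (e * (N + e))) by ring]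
  refine mul_le_mul_of_nonneg_left ?_ hQ.le
  rw [← sub_nonneg]
  have : (N + 1) / N * (1 + e ^ 2 / ((N + 1) ^ 2 * N)) * (e * (N + e)) -
      (1 + 1 / N * (e / (N + 1))) =
      (((N + 1) ^ 2 * N + e ^ 2) * (e * (N + e)) - N * (N * (N + 1) + e) * (e * (N + 1 + e))) /
        (N ^ 2 * (N + 1)) := by
    have h : e * (N + 1 + e) = 1 := by linarith
    rw [h]
    field_simp
  rw [this]
  refine div_nonneg ?_ (by positivity)
  have : ((N + 1) ^ 2 * N + e ^ 2) * (e * (N + e)) - N * (N * (N + 1) + e) * (e * (N + 1 + e)) =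
    e ^ 4 := by ring
  rw [this]
  positivity

theorem one_div_rpow_neg {u : ℝ} (hu : 0 ≤ u) (p : ℝ) : (1 / u) ^ (-p) = u ^ p := by
  rw [one_div, inv_rpow hu, rpow_neg hu, inv_inv]

theorem le_gLow_one_div (hn : 2 ≤ n) :
    bstar n * (1 + 1 / ((n : ℝ) ^ 2 * (n + 1) ^ 2)) ≤ gLow n (1 / n) := by
  have hN : (2 : ℝ) ≤ n := by exact_mod_cast hn
  have h := rpow_one_div_ge (N := n) (u := n) (by linarith) (by linarith) (by linarith)
  unfold gLow
  rw [one_div_rpow_neg (by positivity), bstar_eq (by positivity)]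
  refine le_trans ?_ (add_le_add_left h _)
  have hQ : 0 < ((n : ℝ) + 1) ^ (1 / (n : ℝ)) := by positivity
  set Q := ((n : ℝ) + 1) ^ (1 / (n : ℝ))
  set N : ℝ := (n : ℝ)
  rw [← sub_nonneg]
  have : Q * (N * N / (N * N + (N + 1 - N))) + Q * (N + 1) / N * (1 / N) -
      Q * (N + 1) / N * (1 + 1 / (N ^ 2 * (N + 1) ^ 2)) =
      Q * (N - 1) / (N ^ 3 * (N + 1) * (N ^ 2 + 1)) := by
    rw [show N * N + (N + 1 - N) = N ^ 2 + 1 by ring]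
    field_simp
    ring
  rw [this]
  exact div_nonneg (mul_nonneg hQ.le (by linarith)) (by positivity)

theorem brjunoEta_le_gLow (hn : 2 ≤ n) :
    brjunoEta n (n + 1) ≤ gLow n (1 / (n + 1 / n)) := by
  have hN : (2 : ℝ) ≤ n := by exact_mod_cast hn
  have hN1 : 1 / (n : ℝ) ≤ 1 := by rw [div_le_one (by positivity)]; linarith
  have h := rpow_one_div_ge (N := n) (u := n + 1 / n) (by linarith) (by positivity) (by linarith)
  have he := eta_sq_le (n + 1)
  push_cast at he
  refine (brjunoEta_le hn).trans ?_
  unfold gLow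
  rw [one_div_rpow_neg (by positivity), bstar_eq (by positivity)]
  refine le_trans ?_ (add_le_add_left h _)
  have hQ : 0 < ((n : ℝ) + 1) ^ (1 / (n : ℝ)) := by positivity
  set Q := ((n : ℝ) + 1) ^ (1 / (n : ℝ))
  set e := eta (n + 1)
  set N : ℝ := (n : ℝ)
  calc Q * (N + 1) / N * (1 + e ^ 2 / ((N + 1) ^ 2 * N))
      ≤ Q * (N + 1) / N * (1 + 1 / ((N + 1) ^ 2 + 1) / ((N + 1) ^ 2 * N)) := by gcongr
    _ ≤ _ := by
      obtain ⟨t, ht, hNt⟩ : ∃ t : ℝ, 0 ≤ t ∧ N = t + 2 := ⟨N - 2, by linarith, by ring⟩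
      clear_value N Q
      subst hNt
      have hd : 0 < (t + 2) ^ 3 + 2 * (t + 2) - 1 := by ring_nf; positivity
      have e1 : (t + 2) * (t + 2 + 1 / (t + 2)) /
          ((t + 2) * (t + 2 + 1 / (t + 2)) + (t + 2 + 1 - (t + 2 + 1 / (t + 2)))) =
          (t + 2) * ((t + 2) ^ 2 + 1) / ((t + 2) ^ 3 + 2 * (t + 2) - 1) := by
        have : (t + 2) * (t + 2 + 1 / (t + 2)) + (t + 2 + 1 - (t + 2 + 1 / (t + 2))) =
          ((t + 2) ^ 3 + 2 * (t + 2) - 1) / (t + 2) := by field_simp; ring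
        rw [this]
        field_simp
      have e2 : (1 : ℝ) / (t + 2 + 1 / (t + 2)) = (t + 2) / ((t + 2) ^ 2 + 1) := by
        field_simp
      rw [e1, e2, show ∀ a b c d : ℝ, Q * a + Q * b / c * d = Q * (a + b / c * d) by
        intros; ring, show ∀ a b c : ℝ, Q * a / b * c = Q * (a / b * c) by intros; ring]
      refine mul_le_mul_of_nonneg_left ?_ hQ.le
      rw [← sub_nonneg]
      set D := (t + 2) ^ 3 + 2 * (t + 2) - 1 with hD
      have key : (t + 2) * ((t + 2) ^ 2 + 1) / D + (t + 2 + 1) / (t + 2) *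
          ((t + 2) / ((t + 2) ^ 2 + 1)) - (t + 2 + 1) / (t + 2) *
          (1 + 1 / ((t + 2 + 1) ^ 2 + 1) / ((t + 2 + 1) ^ 2 * (t + 2))) =
          ((t + 2) ^ 3 * ((t + 2) ^ 2 + 1) ^ 2 * (t + 3) * ((t + 3) ^ 2 + 1)
            + (t + 3) ^ 2 * (t + 2) ^ 2 * D * ((t + 3) ^ 2 + 1)
            - (t + 3) ^ 2 * (t + 2) * D * ((t + 3) ^ 2 + 1) * ((t + 2) ^ 2 + 1)
            - D * ((t + 2) ^ 2 + 1)) /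
          (D * ((t + 2) ^ 2 + 1) * (t + 2) ^ 2 * (t + 3) * ((t + 3) ^ 2 + 1)) := by
        rw [show t + 2 + 1 = t + 3 by ring]
        field_simp
        ring
      rw [key]
      refine div_nonneg ?_ (by positivity)
      rw [hD]
      ring_nf
      positivity

theorem sq_eta_mul_le (hn : 2 ≤ n) : eta (n + 1) ^ 2 * ((n : ℝ) * (n + 1)) ≤ 1 := by
  have hN : (2 : ℝ) ≤ n := by exact_mod_cast hn
  have h := eta_sq_le (n + 1)
  push_cast at h
  rw [le_div_iff₀ (by positivity)] at h
  nlinarith [sq_nonneg (eta (n + 1))]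

/-- On `(1/n, 1)` the function `B_n` exceeds `b*` by a definite amount. -/
theorem bstar_mul_le_toReal_brjuno (hn : 2 ≤ n) {x : ℝ} (hx : x ∈ brjunoFinite n)
    (hxn : 1 / (n : ℝ) ≤ x) :
    bstar n * (1 + 1 / ((n : ℝ) ^ 2 * (n + 1) ^ 2)) ≤ (brjuno n x).toReal := by
  have hN : (2 : ℝ) ≤ n := by exact_mod_cast hn
  have hN0 : (0 : ℝ) < n := by linarith
  refine (le_gLow_one_div hn).trans ((gLow_mono hN0 ?_ hxn).trans (gLow_le_toReal_brjuno hN0 hx))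
  gcongr
  linarith

theorem Irrational.ne_one_div {x : ℝ} (hx : Irrational x) (k : ℕ) : x ≠ 1 / (k : ℝ) := by
  rintro rfl
  exact hx ⟨1 / k, by push_cast; rfl⟩

theorem brjunoEta_le_toReal_brjuno_of_ge (hn : 2 ≤ n) {x : ℝ} (hx : x ∈ brjunoFinite n)
    (hxn : 1 / ((n : ℝ) + 1) < x) : brjunoEta n (n + 1) ≤ (brjuno n x).toReal := by
  have hN : (2 : ℝ) ≤ n := by exact_mod_cast hn
  have hN0 : (0 : ℝ) < n := by linarith
  have hb := bstar_pos hN0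
  have hsq := sq_eta_mul_le hn
  have gain : ∀ r : ℝ, 1 / ((n : ℝ) + 1) ≤ r → brjunoEta n (n + 1) ≤
      bstar n * (1 + r * (1 / ((n : ℝ) ^ 2 * (n + 1) ^ 2))) := fun r hr => by
    refine (brjunoEta_le hn).trans (mul_le_mul_of_nonneg_left ?_ hb.le)
    gcongr
    refine le_trans ?_ (mul_le_mul_of_nonneg_right hr (by positivity))
    have : eta (n + 1) ^ 2 ≤ 1 / ((n : ℝ) * (n + 1)) := by
      rwa [le_div_iff₀ (by positivity)]
    calc eta (n + 1) ^ 2 / (((n : ℝ) + 1) ^ 2 * n)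
        ≤ 1 / ((n : ℝ) * (n + 1)) / (((n : ℝ) + 1) ^ 2 * n) := by gcongr
      _ = _ := by field_simp
  rcases le_or_gt (1 / (n : ℝ)) x with h1 | h1
  · have := gain 1 (by rw [div_le_one (by positivity)]; linarith)
    rw [one_mul] at this
    exact this.trans (bstar_mul_le_toReal_brjuno hn hx h1)
  · have hxy := mul_add_gaussMap_eq_one (by omega) hxn h1
    have hy := gaussMap_mem_brjunoFinite hx
    have hx0 := hx.2.1.1
    rcases le_or_gt (1 / (n : ℝ)) (gaussMap x) with h2 | h2
    · refine (gain x hxn.le).trans ?_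
      rw [toReal_brjuno_eq_add hx]
      have h3 := bstar_mul_one_sub_le hN0 hx0
      have h4 := mul_le_mul_of_nonneg_left (bstar_mul_le_toReal_brjuno hn hy h2) hx0.le
      linarith
    · refine (brjunoEta_le_gLow hn).trans ((gLow_mono hN0 ?_ ?_).trans
        (gLow_le_toReal_brjuno hN0 hx))
      · gcongr
        rw [div_le_one hN0]
        linarith
      · have hy0 := hy.2.1.1
        calc 1 / ((n : ℝ) + 1 / n) ≤ 1 / (n + gaussMap x) := by gcongr
          _ = x := (eq_div_of_mul_eq (by positivity) hxy).symm

end Minimum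

section Excess

/-- The excess of `B_n` over its value at the fixed point `η_{n+1}`. -/
noncomputable def brjunoExcess (n : ℕ) (x : ℝ) : ℝ :=
  (brjuno n x).toReal - brjunoEta n (n + 1)

/-- Minus the slope at `η_{n+1}` of `x ↦ x^{-1/n} + x B_n(η_{n+1})`. -/
noncomputable def excessSlope (n : ℕ) : ℝ := brjunoEta n (n + 1) * eta (n + 1) / n

variable {n : ℕ}

theorem excessSlope_pos (hn : 2 ≤ n) : 0 < excessSlope n :=
  div_pos (mul_pos (brjunoEta_pos _ (by omega)) (eta_pos _)) (by positivity)

theorem le_brjunoExcess (hn : 2 ≤ n) {x : ℝ} (hx : x ∈ brjunoFinite n) :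
    excessSlope n * (eta (n + 1) - x) + x * brjunoExcess n (gaussMap x) ≤ brjunoExcess n x := by
  have hN : (0 : ℝ) < n := by positivity
  have h0 := eta_pos (n + 1)
  have h1 : eta (n + 1) < 1 := eta_lt_one (by omega)
  have he := eta_mul_add (n + 1)
  have h := rpow_neg_tangent_le (p := 1 / n) (by positivity) h0 hx.2.1.1
  have hM : eta (n + 1) ^ (-(1 / (n : ℝ))) = brjunoEta n (n + 1) * (1 - eta (n + 1)) := by
    rw [brjunoEta, div_mul_cancel₀ _ (by linarith)]
  unfold brjunoExcess excessSlope
  rw [toReal_brjuno_eq_add hx]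
  rw [hM] at h
  push_cast at he
  set e := eta (n + 1)
  set M := brjunoEta n (n + 1)
  have key : M * (1 - e) * (1 - 1 / n * (x - e) / e) - M * (1 - x) = M * e / n * (e - x) := by
    have : M * (1 - e) * (1 - 1 / n * (x - e) / e) - M * (1 - x) - M * e / n * (e - x) =
      M * (x - e) * (e * (n + 1 + e) - 1) / (n * e) := by
      field_simp
      ring
    rw [← sub_eq_zero, this, he]
    simp
  linarith

theorem neg_le_brjunoExcess (hn : 2 ≤ n) {x : ℝ} (hx : x ∈ brjunoFinite n) :
    -(excessSlope n * eta (n + 1) / ((n : ℝ) + 1) ^ 2) ≤ brjunoExcess n x := by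
  have hN : (0 : ℝ) < n := by positivity
  have h1 := bstar_le_toReal_brjuno hN hx
  have h2 := brjunoEta_le hn
  have h3 := mul_le_mul_of_nonneg_right (bstar_le_brjunoEta hn)
    (by positivity : 0 ≤ eta (n + 1) ^ 2 / (((n : ℝ) + 1) ^ 2 * n))
  have h4 : excessSlope n * eta (n + 1) / ((n : ℝ) + 1) ^ 2 =
      brjunoEta n (n + 1) * (eta (n + 1) ^ 2 / (((n : ℝ) + 1) ^ 2 * n)) := by
    unfold excessSlope
    field_simp
  rw [h4]
  unfold brjunoExcess
  linarith

/-- The two-step lower bound on the cylinder of `η_{n+1}`. -/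
theorem le_brjunoExcess_of_cylinder (hn : 2 ≤ n) {x : ℝ} (hx : x ∈ brjunoFinite n)
    (hxy : x * ((n : ℝ) + 1 + gaussMap x) = 1) :
    excessSlope n * (1 - eta (n + 1)) / eta (n + 1) * (x - eta (n + 1)) +
      x * gaussMap x * brjunoExcess n (gaussMap (gaussMap x)) ≤ brjunoExcess n x := by
  have h0 := eta_pos (n + 1)
  have he := eta_mul_add (n + 1)
  have h1 := le_brjunoExcess hn hx
  have h2 := mul_le_mul_of_nonneg_left (le_brjunoExcess hn (gaussMap_mem_brjunoFinite hx))
    hx.2.1.1.le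
  push_cast at he
  set e := eta (n + 1)
  have h3 : excessSlope n * (1 - e) / e * (x - e) =
      excessSlope n * (e - x) + x * (excessSlope n * (e - gaussMap x)) := by
    have : x - e = e * (x * (e - gaussMap x)) := by linear_combination e * hxy - x * he
    have h4 : excessSlope n * (1 - e) / e * (x - e) =
      excessSlope n * (e - x) + excessSlope n * ((x - e) / e) := by
      field_simp
      ring
    have h5 : (x - e) / e = x * (e - gaussMap x) :=
      (div_eq_iff h0.ne').2 (by linear_combination this)
    rw [h4, h5]
    ring
  linarith

theorem brjunoExcess_nonneg (hn : 2 ≤ n) {x : ℝ} (hx : x ∈ brjunoFinite n) :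
    0 ≤ brjunoExcess n x := by
  have hN : (2 : ℝ) ≤ n := by exact_mod_cast hn
  have h0 := eta_pos (n + 1)
  have h1 : eta (n + 1) < 1 := eta_lt_one (by omega)
  have he := eta_mul_add (n + 1)
  have hem := eta_mul_lt_one (n + 1)
  have hκ := excessSlope_pos hn
  push_cast at he hem
  set e := eta (n + 1) with he_def
  set ε := excessSlope n * e / ((n : ℝ) + 1) ^ 2 with hε_def
  have hε : 0 < ε := by positivity
  have key : ∀ k : ℕ, ∀ x ∈ brjunoFinite n, -(ε * (1 / 2) ^ k) ≤ brjunoExcess n x := by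
    intro k
    induction k with
    | zero =>
      intro x hx
      simpa using neg_le_brjunoExcess hn hx
    | succ k ih =>
      intro x hx
      have hx0 := hx.2.1.1
      have hy := gaussMap_mem_brjunoFinite hx
      have hek : 0 < ε * (1 / 2) ^ k := by positivity
      rw [pow_succ]
      rcases lt_or_ge (1 / ((n : ℝ) + 1)) x with hx1 | hx1
      · have := brjunoEta_le_toReal_brjuno_of_ge hn hx hx1
        unfold brjunoExcess
        linarith
      have hx1' : x < 1 / ((n : ℝ) + 1) := lt_of_le_of_ne hx1 (by
        exact_mod_cast hx.1.ne_one_div (n + 1))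
      have hlin := le_brjunoExcess hn hx
      rcases le_or_gt x (1 / ((n : ℝ) + 1 + 1)) with hx2 | hx2
      · have h2 := mul_le_mul_of_nonneg_left (neg_le_brjunoExcess hn hy) hx0.le
        have h3 : x * e / ((n : ℝ) + 1) ^ 2 ≤ e - x := by
          rw [div_le_iff₀ (by positivity)]
          rw [le_div_iff₀ (by positivity)] at hx2
          have h4 : 1 ≤ ((n : ℝ) + 1) ^ 2 * (1 - e) := by nlinarith
          have h5 : 0 ≤ e * (((n : ℝ) + 1) ^ 2 * (1 - e) - 1) :=
            mul_nonneg h0.le (by linarith)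
          have h6 : 0 ≤ (1 - x * ((n : ℝ) + 1 + 1)) * (((n : ℝ) + 1) ^ 2 + e) :=
            mul_nonneg (by linarith) (by positivity)
          refine le_of_mul_le_mul_right ?_ (by positivity : 0 < (n : ℝ) + 1 + 1)
          linear_combination h5 + h6 - ((n : ℝ) + 1) ^ 2 * he
        have h4 := mul_le_mul_of_nonneg_left h3 hκ.le
        have h5 : excessSlope n * (x * e / ((n : ℝ) + 1) ^ 2) = x * ε := by
          rw [hε_def]; ring
        linarith
      · rcases le_or_gt x e with hxe | hxe
        · have h2 := mul_le_mul_of_nonneg_left (ih _ hy) hx0.le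
          have h3 := mul_nonneg hκ.le (sub_nonneg.2 hxe)
          have h4 : x ≤ 1 / 2 := by
            rw [lt_div_iff₀ (by positivity)] at hx1'
            nlinarith
          nlinarith
        · have hxy := mul_add_gaussMap_eq_one (x := x) (k := n + 1) (by omega)
            (by push_cast; exact hx2) (by push_cast; exact hx1')
          push_cast at hxy
          have h2 := le_brjunoExcess_of_cylinder hn hx hxy
          have h3 := mul_le_mul_of_nonneg_left (ih _ (gaussMap_mem_brjunoFinite hy))
            (mul_nonneg hx0.le hy.2.1.1.le)
          have h4 := mul_gaussMap_le_half hx.1 hx0 hx.2.1.2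
          have h5 : 0 ≤ excessSlope n * (1 - e) / e * (x - e) :=
            mul_nonneg (div_nonneg (mul_nonneg hκ.le (by linarith)) h0.le) (by linarith)
          nlinarith
  have hlim : Filter.Tendsto (fun k : ℕ => -(ε * (1 / 2 : ℝ) ^ k)) Filter.atTop (nhds 0) := by
    simpa using ((tendsto_pow_atTop_nhds_zero_of_lt_one (r := (1 / 2 : ℝ)) (by norm_num)
      (by norm_num)).const_mul ε).neg
  exact le_of_tendsto' hlim fun k => key k x hx

theorem sqrt_mul_mul_le {w e : ℝ} (b : ℝ) (hw : 0 ≤ w) (he : 0 ≤ e) (hwe : w ≤ e ^ 2) :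
    √(w * b) * w ≤ e * (w * √b) := by
  rw [sqrt_mul hw]
  have := mul_le_mul_of_nonneg_right ((sqrt_le_left he).2 hwe) (mul_nonneg hw (sqrt_nonneg b))
  linarith

theorem exists_pos_mul_sqrt_le_brjunoExcess (hn : 2 ≤ n) :
    ∃ c : ℝ, 0 < c ∧ ∀ x ∈ brjunoFinite n, x < 1 / ((n : ℝ) + 1) →
      c * √|x - eta (n + 1)| ≤ brjunoExcess n x := by
  have hN : (2 : ℝ) ≤ n := by exact_mod_cast hn
  have h0 := eta_pos (n + 1)
  have h1 : eta (n + 1) < 1 := eta_lt_one (by omega)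
  have he := eta_mul_add (n + 1)
  have hem := eta_mul_lt_one (n + 1)
  have hκ := excessSlope_pos hn
  push_cast at he hem
  set e := eta (n + 1)
  set κ := excessSlope n
  have hδ₀ : 0 < e - 1 / ((n : ℝ) + 1 + 1) := by
    rw [sub_pos, div_lt_iff₀ (by positivity)]
    nlinarith
  have hδ₁ : 0 < 1 / ((n : ℝ) + 1) - e := by
    rw [sub_pos, lt_div_iff₀ (by positivity)]
    exact hem
  set δ₀ := e - 1 / ((n : ℝ) + 1 + 1) with hδ₀_def
  set δ₁ := 1 / ((n : ℝ) + 1) - e with hδ₁_def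
  set r := e / ((n : ℝ) + 1 + 1) with hr_def
  have hr : 0 < r := by positivity
  set δ := min δ₀ δ₁
  have hδ : 0 < δ := lt_min hδ₀ hδ₁
  have h1e : 0 < 1 - e := by linarith
  obtain ⟨c, hc, hc₀, hc₁, hc₂, hc₃⟩ : ∃ c : ℝ, 0 < c ∧ c ≤ κ * δ₀ ∧ c ≤ κ * (r * δ) ∧
      c ≤ κ * (1 - e) / e * (r * (r * δ)) ∧ c ≤ κ * (1 - e) * e / ((n : ℝ) + 1) := by
    refine ⟨min (min (κ * δ₀) (κ * (r * δ))) (min (κ * (1 - e) / e * (r * (r * δ)))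
      (κ * (1 - e) * e / ((n : ℝ) + 1))), ?_, ?_, ?_, ?_, ?_⟩
    · refine lt_min (lt_min ?_ ?_) (lt_min ?_ ?_) <;> positivity
    · exact (min_le_left _ _).trans (min_le_left _ _)
    · exact (min_le_left _ _).trans (min_le_right _ _)
    · exact (min_le_right _ _).trans (min_le_left _ _)
    · exact (min_le_right _ _).trans (min_le_right _ _)
  have hc₄ : c ≤ κ * e := by
    refine hc₃.trans ((div_le_iff₀ (by positivity)).2 ?_)
    have : 0 < κ * e := by positivity
    nlinarith
  refine ⟨c, hc, ?_⟩
  have hsqrt : ∀ x ∈ brjunoFinite n, √|x - e| ≤ 1 := fun x hx => by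
    refine sqrt_le_iff.2 ⟨zero_le_one, ?_⟩
    rw [one_pow, abs_le]
    constructor <;> linarith [hx.2.1.1, hx.2.1.2]
  have key : ∀ k : ℕ, ∀ x ∈ brjunoFinite n, x < 1 / ((n : ℝ) + 1) →
      c * (√|x - e| - (1 / 2) ^ k) ≤ brjunoExcess n x := by
    intro k
    induction k with
    | zero =>
      intro x hx _
      have := brjunoExcess_nonneg hn hx
      have := hsqrt x hx
      rw [pow_zero]
      nlinarith
    | succ k ih =>
      intro x hx hx1
      have hx0 := hx.2.1.1
      have hy := gaussMap_mem_brjunoFinite hx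
      have hz := gaussMap_mem_brjunoFinite hy
      have hpow : (0 : ℝ) < (1 / 2) ^ k := by positivity
      have hs := hsqrt x hx
      have hs0 := sqrt_nonneg |x - e|
      have hconst : c ≤ brjunoExcess n x →
          c * (√|x - e| - (1 / 2) ^ (k + 1)) ≤ brjunoExcess n x := fun h => by
        rw [pow_succ]
        nlinarith
      have hlin := le_brjunoExcess hn hx
      have hy0 := mul_nonneg hx0.le (brjunoExcess_nonneg hn hy)
      rcases le_or_gt x (1 / ((n : ℝ) + 1 + 1)) with hx2 | hx2
      · apply hconst
        have := mul_le_mul_of_nonneg_left (by linarith : δ₀ ≤ e - x) hκ.le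
        linarith
      have hxy := mul_add_gaussMap_eq_one (x := x) (k := n + 1) (by omega)
        (by push_cast; exact hx2) (by push_cast; exact hx1)
      push_cast at hxy
      have hxe : e - x = x * e * (gaussMap x - e) := by linear_combination x * he - e * hxy
      have far : ∀ u v d : ℝ, 1 / ((n : ℝ) + 1 + 1) < u → 0 ≤ d → d ≤ v →
          r * d ≤ u * e * v := fun u v d hu hd hv => by
        have hu' : r ≤ u * e := by
          rw [hr_def, div_eq_mul_one_div, mul_comm]
          exact mul_le_mul_of_nonneg_right hu.le h0.le
        exact mul_le_mul hu' hv hd (hr.le.trans hu')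
      rcases le_or_gt x e with hle | hlt
      · rcases le_or_gt (1 / ((n : ℝ) + 1)) (gaussMap x) with hy1 | hy1
        · apply hconst
          have := mul_le_mul_of_nonneg_left (far x (gaussMap x - e) δ hx2 hδ.le
            ((min_le_right _ _).trans (by linarith))) hκ.le
          rw [← hxe] at this
          linarith
        · have h2 := mul_le_mul_of_nonneg_left (ih _ hy hy1) hx0.le
          have hx_half : x ≤ 1 / 2 := by
            rw [lt_div_iff₀ (by positivity)] at hx1
            nlinarith
          have h3 : √|x - e| * x ≤ e * (x * √|gaussMap x - e|) := by
            have h := sqrt_mul_mul_le |gaussMap x - e| (mul_nonneg hx0.le h0.le) h0.le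
              (by nlinarith : x * e ≤ e ^ 2)
            rw [← abs_of_nonneg (mul_nonneg hx0.le h0.le), ← abs_mul,
              abs_of_nonneg (mul_nonneg hx0.le h0.le), ← hxe, abs_sub_comm] at h
            refine le_of_mul_le_mul_right ?_ h0
            linarith
          have h4 : c * √|x - e| ≤ κ * (e - x) + c * (x * √|gaussMap x - e|) := by
            refine le_of_mul_le_mul_left ?_ h0
            have h5 := mul_le_mul_of_nonneg_left h3 hc.le
            have h6 : c * ((e - x) * √|x - e|) ≤ κ * e * (e - x) := by
              have : (e - x) * √|x - e| ≤ e - x := mul_le_of_le_one_right (by linarith) hs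
              have h7 := mul_le_mul_of_nonneg_left this hc.le
              have h8 := mul_le_mul_of_nonneg_right hc₄ (sub_nonneg.2 hle)
              linarith
            linarith
          have h9 := mul_le_mul_of_nonneg_right hx_half (mul_nonneg hc.le hpow.le)
          rw [pow_succ]
          linarith
      · have hcyl := le_brjunoExcess_of_cylinder hn hx hxy
        have hxy0 : 0 < x * gaussMap x := mul_pos hx0 hy.2.1.1
        have hz0 := mul_nonneg hxy0.le (brjunoExcess_nonneg hn hz)
        have hκe : 0 < κ * (1 - e) / e := by positivity
        have hye : gaussMap x ≤ e := by
          by_contra! h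
          have : 0 < x * e * (gaussMap x - e) := mul_pos (by positivity) (by linarith)
          linarith
        have hxe' : x - e = x * e * (e - gaussMap x) := by linear_combination -hxe
        have hconst' : r * (r * δ) ≤ x - e →
            c * (√|x - e| - (1 / 2) ^ (k + 1)) ≤ brjunoExcess n x := fun h => by
          apply hconst
          have := mul_le_mul_of_nonneg_left h hκe.le
          linarith
        have hr1 : r ≤ 1 := by
          rw [hr_def, div_le_one (by positivity)]
          linarith
        rcases le_or_gt (gaussMap x) (1 / ((n : ℝ) + 1 + 1)) with hy2 | hy2
        · apply hconst'
          rw [hxe']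
          refine far x _ _ hx2 (by positivity) ((mul_le_of_le_one_left hδ.le hr1).trans
            ((min_le_left _ _).trans ?_))
          linarith
        have hy1 : gaussMap x < 1 / ((n : ℝ) + 1) := by linarith
        have hyz := mul_add_gaussMap_eq_one (x := gaussMap x) (k := n + 1) (by omega)
          (by push_cast; exact hy2) (by push_cast; exact hy1)
        push_cast at hyz
        have hye' : e - gaussMap x = gaussMap x * e * (gaussMap (gaussMap x) - e) := by
          linear_combination gaussMap x * he - e * hyz
        rcases le_or_gt (1 / ((n : ℝ) + 1)) (gaussMap (gaussMap x)) with hz1 | hz1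
        · apply hconst'
          rw [hxe', hye']
          refine far x _ _ hx2 (by positivity) (far _ _ _ hy2 hδ.le ((min_le_right _ _).trans ?_))
          linarith
        have h2 := mul_le_mul_of_nonneg_left (ih _ hz hz1) hxy0.le
        have hxz : x - e = x * gaussMap x * e ^ 2 * (gaussMap (gaussMap x) - e) := by
          rw [hxe', hye']; ring
        have hxy_eq : x * gaussMap x = e ^ 2 - (n + 1) * (x - e) := by
          linear_combination hxy - he
        have hw : x * gaussMap x ≤ e ^ 2 := by
          have : 0 ≤ ((n : ℝ) + 1) * (x - e) := mul_nonneg (by positivity) (by linarith)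
          linarith
        have h3 : √|x - e| * (x * gaussMap x) ≤
            e ^ 2 * (x * gaussMap x * √|gaussMap (gaussMap x) - e|) := by
          have h := sqrt_mul_mul_le |gaussMap (gaussMap x) - e| hxy0.le h0.le hw
          have habs : |x - e| =
              e ^ 2 * (x * gaussMap x * |gaussMap (gaussMap x) - e|) := by
            rw [hxz, abs_mul, abs_of_nonneg (by positivity)]
            ring
          rw [habs, sqrt_mul (by positivity), sqrt_sq h0.le]
          have := mul_le_mul_of_nonneg_left h h0.le
          linarith
        have h4 : c * √|x - e| ≤ κ * (1 - e) / e * (x - e) +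
            c * (x * gaussMap x * √|gaussMap (gaussMap x) - e|) := by
          refine le_of_mul_le_mul_left ?_ (by positivity : 0 < e ^ 2)
          have h5 := mul_le_mul_of_nonneg_left h3 hc.le
          have h6 : c * (n + 1) * ((x - e) * √|x - e|) ≤ κ * (1 - e) * e * (x - e) := by
            have h7 : (x - e) * √|x - e| ≤ x - e := mul_le_of_le_one_right (by linarith) hs
            rw [le_div_iff₀ (by positivity)] at hc₃
            exact (mul_le_mul_of_nonneg_left h7 (by positivity)).trans
              (mul_le_mul_of_nonneg_right hc₃ (by linarith))
          have h8 : e ^ 2 * (κ * (1 - e) / e * (x - e)) = κ * (1 - e) * e * (x - e) := by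
            field_simp
          have h9 : c * (√|x - e| * (x * gaussMap x)) =
              e ^ 2 * (c * √|x - e|) - c * (n + 1) * ((x - e) * √|x - e|) := by
            rw [hxy_eq]; ring
          rw [mul_add, h8]
          linarith
        have h9 := mul_le_mul_of_nonneg_right (mul_gaussMap_le_half hx.1 hx0 hx.2.1.2)
          (mul_nonneg hc.le hpow.le)
        rw [pow_succ]
        linarith
  intro x hx hx1
  have hlim : Filter.Tendsto (fun k : ℕ => c * (√|x - e| - (1 / 2 : ℝ) ^ k)) Filter.atTop
      (nhds (c * √|x - e|)) := by
    simpa using ((tendsto_pow_atTop_nhds_zero_of_lt_one (r := (1 / 2 : ℝ)) (by norm_num)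
      (by norm_num)).const_sub √|x - e|).const_mul c
  exact le_of_tendsto' hlim fun k => key k x hx hx1

end Excess

/-- square-root scaling of `B_n` at its global minimum `η_{n+1}`:
`B_n(x) − B_n(η_{n+1}) ≥ c_n·|x − η_{n+1}|^{1/2}` on `(0, 1/(n+1)]`. -/
theorem brjuno_sqrt_scaling (n : ℕ) (hn : 2 ≤ n) :
    ∃ c : ℝ, 0 < c ∧ ∀ x : ℝ, Irrational x → x ∈ Set.Ioc (0 : ℝ) (1 / ((n : ℝ) + 1)) →
      ENNReal.ofReal (c * |x - eta (n + 1)| ^ ((1 : ℝ) / 2)) ≤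
        brjuno n x - brjuno n (eta (n + 1)) := by
  obtain ⟨c, hc, h⟩ := exists_pos_mul_sqrt_le_brjunoExcess hn
  refine ⟨c, hc, fun x hi hx => ?_⟩
  rw [brjuno_eta n (by omega)]
  rcases eq_or_ne (brjuno n x) ⊤ with htop | hfin
  · rw [htop, ENNReal.top_sub ENNReal.ofReal_ne_top]
    exact le_top
  have hx1 : x < 1 / ((n : ℝ) + 1) := lt_of_le_of_ne hx.2 (by
    exact_mod_cast hi.ne_one_div (n + 1))
  have hlt : x < 1 := hx1.trans_le (by
    rw [div_le_one (by positivity)]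
    linarith [(n.cast_nonneg : (0 : ℝ) ≤ n)])
  rw [← ENNReal.ofReal_toReal hfin, ← ENNReal.ofReal_sub _ (brjunoEta_pos _ (by omega)).le,
    ← sqrt_eq_rpow]
  exact ENNReal.ofReal_le_ofReal (h x ⟨hi, ⟨hx.1, hlt⟩, hfin⟩ hx1)
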